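/- For α > 0 and β ≥ 0, define h(x) = E[e^{−α σ_x + β (x + X_{σ_x})} 1_{{σ_x < ∞}}] for x ∈ ℝ, where σ_x = inf{t ≥ 0 : x + X_t < 0}. Then h is Borel measurable, and for every x ∈ ℝ the stopped process t ↦ e^{−α (t ∧ σ_x)} h(x + X_{t ∧ σ_x}) is a martingale with respect to (F_t)_{t ≥ 0}. -/

import Mathlib

open MeasureTheory ProbabilityTheory Set Filter
open scoped ENNReal NNReal Classical

noncomputable section

namespace AKLevy

variable {Ω : Type*}

/-- Running supremum `X̄_t = sup_{0 ≤ s ≤ t} X_s` of a process. -/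
def runSup (X : ℝ → Ω → ℝ) (t : ℝ) (ω : Ω) : ℝ :=
  sSup ((fun s => X s ω) '' Set.Icc 0 t)

/-- Running infimum `X̲_t = inf_{0 ≤ s ≤ t} X_s` of a process. -/
def runInf (X : ℝ → Ω → ℝ) (t : ℝ) (ω : Ω) : ℝ :=
  sInf ((fun s => X s ω) '' Set.Icc 0 t)

/-- All-time supremum `X̄_∞ = sup_{t ≥ 0} X_t`. -/
def supAll (X : ℝ → Ω → ℝ) (ω : Ω) : ℝ :=
  sSup ((fun s => X s ω) '' Set.Ici 0)

/-- All-time infimum `X̲_∞ = inf_{t ≥ 0} X_t`. -/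
def infAll (X : ℝ → Ω → ℝ) (ω : Ω) : ℝ :=
  sInf ((fun s => X s ω) '' Set.Ici 0)

/-- `X` is a real-valued Lévy process with respect to the filtration `ℱ`,
on a filtered probability space satisfying the usual conditions. -/
structure IsLevy [m0 : MeasurableSpace Ω] (P : Measure Ω) (ℱ : Filtration ℝ m0)
    (X : ℝ → Ω → ℝ) : Prop where
  isProb : IsProbabilityMeasure P
  adapted : ∀ t : ℝ, 0 ≤ t → StronglyMeasurable[ℱ t] (X t)
  zero : ∀ᵐ ω ∂P, X 0 ω = 0
  rightCont : ∀ ω, ∀ t : ℝ, 0 ≤ t → ContinuousWithinAt (fun s => X s ω) (Set.Ici t) t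
  leftLim : ∀ ω, ∀ t : ℝ, 0 < t →
    ∃ l : ℝ, Tendsto (fun s => X s ω) (nhdsWithin t (Set.Iio t)) (nhds l)
  indepIncrements : ∀ s t : ℝ, 0 ≤ s → s ≤ t →
    Indep (MeasurableSpace.comap (fun ω => X t ω - X s ω) inferInstance) (ℱ s) P
  stationary : ∀ s t : ℝ, 0 ≤ s → s ≤ t →
    Measure.map (fun ω => X t ω - X s ω) P = Measure.map (X (t - s)) P
  filtRightCont : ∀ t : ℝ, (ℱ t : MeasurableSpace Ω) = ⨅ s ∈ Set.Ioi t, (ℱ s : MeasurableSpace Ω)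
  complete : ∀ N : Set Ω, MeasurableSet N → P N = 0 → MeasurableSet[ℱ 0] N

/-- `τ_x^+ < ∞`: the process passes strictly above level `x` at some nonnegative time. -/
def hitsAbove (X : ℝ → Ω → ℝ) (x : ℝ) (ω : Ω) : Prop := ∃ t, 0 ≤ t ∧ x < X t ω

/-- First passage time above `x`:  `τ_x^+ = inf {t ≥ 0 : X_t > x}` (junk value if never). -/
def tauAbove (X : ℝ → Ω → ℝ) (x : ℝ) (ω : Ω) : ℝ := sInf {t : ℝ | 0 ≤ t ∧ x < X t ω}

/-- `τ_x^- < ∞`: the process passes strictly below level `x` at some nonnegative time. -/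
def hitsBelow (X : ℝ → Ω → ℝ) (x : ℝ) (ω : Ω) : Prop := ∃ t, 0 ≤ t ∧ X t ω < x

/-- First passage time below `x`:  `τ_x^- = inf {t ≥ 0 : X_t < x}` (junk value if never). -/
def tauBelow (X : ℝ → Ω → ℝ) (x : ℝ) (ω : Ω) : ℝ := sInf {t : ℝ | 0 ≤ t ∧ X t ω < x}

/-- The `[0,∞]`-valued first passage time `σ_x = inf { t ≥ 0 : x + X_t < y }`, with `inf ∅ = ∞`. -/
def hitBelowE (X : ℝ → Ω → ℝ) (y x : ℝ) (ω : Ω) : ℝ≥0∞ :=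
  if ∃ t, 0 ≤ t ∧ x + X t ω < y then ENNReal.ofReal (sInf {t : ℝ | 0 ≤ t ∧ x + X t ω < y})
  else ∞

/-- The stopped clock `t ∧ σ_x` (real-valued), where `σ_x = inf{ t ≥ 0 : x + X_t < y}`. -/
def stoppedClock (X : ℝ → Ω → ℝ) (y x : ℝ) (t : ℝ) (ω : Ω) : ℝ :=
  (min (ENNReal.ofReal t) (hitBelowE X y x ω)).toReal

/-- A `[0,∞]`-valued stopping time of the filtration `ℱ`. -/
def IsStopTime [m0 : MeasurableSpace Ω] (ℱ : Filtration ℝ m0) (τ : Ω → ℝ≥0∞) : Prop :=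
  ∀ t : ℝ, 0 ≤ t → MeasurableSet[ℱ t] {ω | τ ω ≤ ENNReal.ofReal t}

/-- Discounted payoff `e^{-rτ} G(x + X_τ)` at a `[0,∞]`-valued time `τ`, set to `0` on `{τ = ∞}`. -/
def stopPayoff (X : ℝ → Ω → ℝ) (r x : ℝ) (G : ℝ → ℝ) (τ : Ω → ℝ≥0∞) (ω : Ω) : ℝ :=
  if τ ω ≠ ∞ then Real.exp (-(r * (τ ω).toReal)) * G (x + X ((τ ω).toReal) ω) else 0

/-- Discounted American put payoff `e^{-rτ}(K - e^{x + X_τ})^+ 1_{τ < ∞}`. -/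
def putPayoff (X : ℝ → Ω → ℝ) (r K x : ℝ) (τ : Ω → ℝ≥0∞) (ω : Ω) : ℝ :=
  stopPayoff X r x (fun z => max (K - Real.exp z) 0) τ ω

/-- Value function `v(x) = sup_τ E[e^{-rτ}(K - e^{x+X_τ})^+ 1_{τ<∞}]`, the supremum
being over all `[0,∞]`-valued stopping times of `ℱ`. -/
def putValue [m0 : MeasurableSpace Ω] (P : Measure Ω) (ℱ : Filtration ℝ m0)
    (X : ℝ → Ω → ℝ) (r K x : ℝ) : ℝ :=
  ⨆ τ : {τ : Ω → ℝ≥0∞ // IsStopTime ℱ τ}, ∫ ω, putPayoff X r K x τ.1 ω ∂P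

/-- `m = E[e^{X̲_{e_r}}]`, where `e_r` is an independent exponential time of rate `r > 0`,
and `e_0 = ∞`. -/
def mInf [m0 : MeasurableSpace Ω] (P : Measure Ω) (X : ℝ → Ω → ℝ) (r : ℝ) : ℝ :=
  if 0 < r then
    ∫ t in Set.Ioi (0 : ℝ), r * Real.exp (-(r * t)) * (∫ ω, Real.exp (runInf X t ω) ∂P)
  else ∫ ω, Real.exp (infAll X ω) ∂P

/-- `P(X̲_{e_r} = 0)`, where `e_r` is an independent exponential time of rate `r > 0`,
and `e_0 = ∞`. -/
def atomZeroProb [m0 : MeasurableSpace Ω] (P : Measure Ω) (X : ℝ → Ω → ℝ) (r : ℝ) : ℝ :=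
  if 0 < r then
    ∫ t in Set.Ioi (0 : ℝ), r * Real.exp (-(r * t)) * (P {ω | runInf X t ω = 0}).toReal
  else (P {ω | infAll X ω = 0}).toReal

/-- The event `{τ_0^- = 0}`: `0` is (pathwise) immediately reached from below, i.e.
`inf{t ≥ 0 : X_t < 0} = 0`. -/
def regularBelow (X : ℝ → Ω → ℝ) : Set Ω :=
  {ω | ∀ ε > (0 : ℝ), ∃ t, 0 ≤ t ∧ t < ε ∧ X t ω < 0}

/-- `E[e^{-γ X̄_{e_α}}] = ∫_0^∞ α e^{-α t} E[e^{-γ X̄_t}] dt`. -/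
def expSupLT [m0 : MeasurableSpace Ω] (P : Measure Ω) (X : ℝ → Ω → ℝ) (α γ : ℝ) : ℝ :=
  ∫ t in Set.Ioi (0 : ℝ), α * Real.exp (-(α * t)) * (∫ ω, Real.exp (-(γ * runSup X t ω)) ∂P)

/-- The function `h_{α,β}(x) = E[e^{-α σ_x + β (x + X_{σ_x})} 1_{σ_x < ∞}]`, where
`σ_x = inf{t ≥ 0 : x + X_t < 0}`. -/
def hAB [m0 : MeasurableSpace Ω] (P : Measure Ω) (X : ℝ → Ω → ℝ) (α β : ℝ) (z : ℝ) : ℝ :=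
  ∫ ω, (if hitsBelow X (-z) ω then
      Real.exp (-(α * tauBelow X (-z) ω) + β * (z + X (tauBelow X (-z) ω) ω)) else 0) ∂P

/-- `v_y(x) = E[e^{-r σ_x} (K - e^{x + X_{σ_x}})^+ 1_{σ_x<∞}]` where
`σ_x = inf{t ≥ 0 : x + X_t < y}`. -/
def vy [m0 : MeasurableSpace Ω] (P : Measure Ω) (X : ℝ → Ω → ℝ) (r K y : ℝ) (z : ℝ) : ℝ :=
  ∫ ω, putPayoff X r K z (hitBelowE X y z) ω ∂P

/-- The process `f` (indexed by `t ≥ 0`) is a martingale with respect to `ℱ` and `P`. -/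
def MartOn [m0 : MeasurableSpace Ω] (P : Measure Ω) (ℱ : Filtration ℝ m0)
    (f : ℝ → Ω → ℝ) : Prop :=
  (∀ t : ℝ, 0 ≤ t → StronglyMeasurable[ℱ t] (f t)) ∧
  (∀ t : ℝ, 0 ≤ t → Integrable (f t) P) ∧
  ∀ s t : ℝ, 0 ≤ s → s ≤ t → P[f t|ℱ s] =ᵐ[P] f s

/-- The process `f` (indexed by `t ≥ 0`) is a supermartingale w.r.t. `ℱ` and `P`. -/
def SupermartOn [m0 : MeasurableSpace Ω] (P : Measure Ω) (ℱ : Filtration ℝ m0)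
    (f : ℝ → Ω → ℝ) : Prop :=
  (∀ t : ℝ, 0 ≤ t → StronglyMeasurable[ℱ t] (f t)) ∧
  (∀ t : ℝ, 0 ≤ t → Integrable (f t) P) ∧
  ∀ s t : ℝ, 0 ≤ s → s ≤ t → P[f t|ℱ s] ≤ᵐ[P] f s

open scoped Topology

section Paths

variable {E : Type*}

lemma exists_lt_iff_exists_rat {f : ℝ → ℝ}
    (hf : ∀ t : ℝ, 0 ≤ t → ContinuousWithinAt f (Ici t) t) (c s : ℝ) :
    (∃ u, 0 ≤ u ∧ u < s ∧ f u < c) ↔ ∃ q : ℚ, 0 ≤ (q : ℝ) ∧ (q : ℝ) < s ∧ f q < c := by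
  refine ⟨?_, fun ⟨q, hq⟩ => ⟨q, hq⟩⟩
  rintro ⟨u, hu0, hus, huc⟩
  have h1 : ∀ᶠ v in 𝓝[≥] u, f v < c := (hf u hu0).eventually_lt_const huc
  obtain ⟨b, hb, hsub⟩ := (mem_nhdsGE_iff_exists_Ico_subset).1 h1
  obtain ⟨q, hq1, hq2⟩ := exists_rat_btwn (lt_min hb hus)
  exact ⟨q, hu0.trans hq1.le, hq2.trans_le (min_le_right _ _),
    hsub ⟨hq1.le, hq2.trans_le (min_le_left _ _)⟩⟩

lemma measurableSet_exists_lt {m : MeasurableSpace E} {X : ℝ → E → ℝ}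
    (hr : ∀ ω, ∀ t : ℝ, 0 ≤ t → ContinuousWithinAt (fun s => X s ω) (Ici t) t) (c s : ℝ)
    (hm : ∀ t, 0 ≤ t → t < s → Measurable (X t)) :
    MeasurableSet {ω | ∃ u, 0 ≤ u ∧ u < s ∧ X u ω < c} := by
  simp_rw [fun ω => exists_lt_iff_exists_rat (hr ω) c s, ofPred_exists]
  refine MeasurableSet.iUnion fun q => ?_
  by_cases h : 0 ≤ (q : ℝ) ∧ (q : ℝ) < s
  · simp only [h.1, h.2, true_and]
    exact measurableSet_lt (hm q h.1 h.2) measurable_const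
  · convert MeasurableSet.empty
    ext ω
    simp only [mem_ofPred_eq, mem_empty_iff_false, iff_false]
    exact fun h' => h ⟨h'.1, h'.2.1⟩

lemma measurableSet_hitsBelow {m : MeasurableSpace E} {X : ℝ → E → ℝ}
    (hm : ∀ t, 0 ≤ t → Measurable (X t))
    (hr : ∀ ω, ∀ t : ℝ, 0 ≤ t → ContinuousWithinAt (fun s => X s ω) (Ici t) t) (c : ℝ) :
    MeasurableSet {ω | hitsBelow X c ω} := by
  have : {ω | hitsBelow X c ω} = ⋃ n : ℕ, {ω | ∃ u : ℝ, 0 ≤ u ∧ u < n ∧ X u ω < c} := by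
    ext ω
    simp only [hitsBelow, mem_ofPred_eq, mem_iUnion]
    constructor
    · rintro ⟨t, h0, h1⟩
      obtain ⟨n, hn⟩ := exists_nat_gt t
      exact ⟨n, t, h0, hn, h1⟩
    · rintro ⟨n, t, h0, -, h1⟩
      exact ⟨t, h0, h1⟩
  rw [this]
  exact MeasurableSet.iUnion fun n => measurableSet_exists_lt hr c n fun t ht _ => hm t ht

lemma tauBelow_nonneg (X : ℝ → E → ℝ) (c : ℝ) (ω : E) : 0 ≤ tauBelow X c ω :=
  Real.sInf_nonneg fun _ h => h.1

lemma tauBelow_lt_iff {X : ℝ → E → ℝ} {c : ℝ} {ω : E} (h : hitsBelow X c ω) (s : ℝ) :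
    tauBelow X c ω < s ↔ ∃ u, 0 ≤ u ∧ u < s ∧ X u ω < c := by
  rw [tauBelow, csInf_lt_iff (s := {t : ℝ | 0 ≤ t ∧ X t ω < c}) ⟨0, fun _ h => h.1⟩ h]
  constructor
  · rintro ⟨u, ⟨h0, h1⟩, h2⟩
    exact ⟨u, h0, h2, h1⟩
  · rintro ⟨u, h0, h2, h1⟩
    exact ⟨u, ⟨h0, h1⟩, h2⟩

lemma apply_tauBelow_le {X : ℝ → E → ℝ} {c : ℝ} {ω : E}
    (hr : ∀ t : ℝ, 0 ≤ t → ContinuousWithinAt (fun s => X s ω) (Ici t) t)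
    (h : hitsBelow X c ω) : X (tauBelow X c ω) ω ≤ c := by
  by_contra! hc
  have h1 : ∀ᶠ v in 𝓝[≥] (tauBelow X c ω), c < X v ω :=
    (hr _ (tauBelow_nonneg X c ω)).eventually_const_lt hc
  obtain ⟨b, hb, hsub⟩ := (mem_nhdsGE_iff_exists_Ico_subset).1 h1
  obtain ⟨u, hu0, hub, huc⟩ := (tauBelow_lt_iff h b).1 hb
  have hu : tauBelow X c ω ≤ u := csInf_le ⟨0, fun _ h => h.1⟩ ⟨hu0, huc⟩
  exact lt_asymm huc (hsub ⟨hu, hub⟩)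

lemma measurable_tauBelow {m : MeasurableSpace E} {X : ℝ → E → ℝ}
    (hm : ∀ t, 0 ≤ t → Measurable (X t))
    (hr : ∀ ω, ∀ t : ℝ, 0 ≤ t → ContinuousWithinAt (fun s => X s ω) (Ici t) t) (c : ℝ) :
    Measurable (tauBelow X c) := by
  refine measurable_of_Iio fun s => ?_
  have : tauBelow X c ⁻¹' Iio s = ({ω | hitsBelow X c ω} ∩ {ω | ∃ u, 0 ≤ u ∧ u < s ∧ X u ω < c})
      ∪ ({ω | hitsBelow X c ω}ᶜ ∩ {_ω | 0 < s}) := by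
    ext ω
    by_cases h : hitsBelow X c ω
    · simp [h, tauBelow_lt_iff h]
    · have : tauBelow X c ω = 0 := by
        have : {t : ℝ | 0 ≤ t ∧ X t ω < c} = ∅ := by
          ext t
          simpa using fun h0 => not_lt.1 fun h1 => h ⟨t, h0, h1⟩
        rw [tauBelow, this, Real.sInf_empty]
      simp [h, this]
  rw [this]
  have h1 := measurableSet_hitsBelow hm hr c
  exact (h1.inter (measurableSet_exists_lt hr c s fun t ht _ => hm t ht)).union
    (h1.compl.inter (MeasurableSet.const _))

/-- The smallest multiple of `1 / (n + 1)` strictly larger than `r`. -/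
def gridAbove (n : ℕ) (r : ℝ) : ℝ := (⌊((n : ℝ) + 1) * r⌋₊ + 1) / ((n : ℝ) + 1)

lemma lt_gridAbove (n : ℕ) (r : ℝ) : r < gridAbove n r := by
  rw [gridAbove, lt_div_iff₀ (by positivity), mul_comm]
  exact Nat.lt_floor_add_one _

lemma gridAbove_nonneg (n : ℕ) (r : ℝ) : 0 ≤ gridAbove n r := by
  rw [gridAbove]; positivity

lemma tendsto_gridAbove {r : ℝ} (hr : 0 ≤ r) :
    Tendsto (fun n => gridAbove n r) atTop (𝓝[≥] r) := by
  refine tendsto_nhdsWithin_iff.2 ⟨?_, Eventually.of_forall fun n => (lt_gridAbove n r).le⟩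
  have h2 : Tendsto (fun n : ℕ => r + 1 / ((n : ℝ) + 1)) atTop (𝓝 r) := by
    simpa using tendsto_const_nhds.add (tendsto_one_div_add_atTop_nhds_zero_nat (𝕜 := ℝ))
  refine tendsto_of_tendsto_of_tendsto_of_le_of_le tendsto_const_nhds h2
    (fun n => (lt_gridAbove n r).le) fun n => ?_
  have hn : (0 : ℝ) < n + 1 := by positivity
  simp only [gridAbove]
  have h1 : (r + 1 / ((n : ℝ) + 1)) * ((n : ℝ) + 1) = ((n : ℝ) + 1) * r + 1 := by field_simp
  rw [div_le_iff₀ hn, h1]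
  gcongr
  exact Nat.floor_le (mul_nonneg hn.le hr)

lemma measurable_gridAbove {m : MeasurableSpace E} {ρ : E → ℝ} (hρ : Measurable ρ) (n : ℕ) :
    Measurable fun ω => gridAbove n (ρ ω) := by
  unfold gridAbove
  have : Measurable fun ω => ⌊((n : ℝ) + 1) * ρ ω⌋₊ := Nat.measurable_floor.comp (hρ.const_mul _)
  have h2 : Measurable fun k : ℕ => ((k : ℝ) + 1) / ((n : ℝ) + 1) := measurable_from_top
  exact h2.comp this

lemma measurable_eval_of_rightCont {m : MeasurableSpace E} {X : ℝ → E → ℝ}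
    (hm : ∀ t, 0 ≤ t → Measurable (X t))
    (hr : ∀ ω, ∀ t : ℝ, 0 ≤ t → ContinuousWithinAt (fun s => X s ω) (Ici t) t)
    {ρ : E → ℝ} (hρ : Measurable ρ) (h0 : ∀ ω, 0 ≤ ρ ω) :
    Measurable fun ω => X (ρ ω) ω := by
  refine measurable_of_tendsto_metrizable (f := fun n ω => X (gridAbove n (ρ ω)) ω) (fun n => ?_)
    (tendsto_pi_nhds.2 fun ω => ((hr ω _ (h0 ω)).tendsto).comp (tendsto_gridAbove (h0 ω)))
  have h1 : Measurable fun p : ℕ × E => X ((p.1 + 1) / ((n : ℝ) + 1)) p.2 :=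
    measurable_from_prod_countable_right fun k => hm _ (div_nonneg (add_nonneg k.cast_nonneg zero_le_one) (by positivity))
  have h2 : Measurable fun ω => (⌊((n : ℝ) + 1) * ρ ω⌋₊, ω) :=
    (Nat.measurable_floor.comp (hρ.const_mul _)).prodMk measurable_id
  exact h1.comp h2

end Paths

section Markov

variable [m0 : MeasurableSpace Ω] {P : Measure Ω} {ℱ : Filtration ℝ m0} {X : ℝ → Ω → ℝ}

lemma IsLevy.measurable (hX : IsLevy P ℱ X) {t : ℝ} (ht : 0 ≤ t) : Measurable (X t) :=
  ((hX.adapted t ht).mono (ℱ.le t)).measurable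

lemma IsLevy.integral_mul_exp_increment (hX : IsLevy P ℱ X) {r t : ℝ} (hr : 0 ≤ r) (hrt : r ≤ t)
    {W : Ω → ℂ} (hW : StronglyMeasurable[ℱ r] W) {B : Set Ω} (hB : MeasurableSet[ℱ r] B) (ξ : ℝ) :
    ∫ ω in B, W ω * Complex.exp ((ξ * (X t ω - X r ω) : ℝ) * Complex.I) ∂P =
      (∫ ω in B, W ω ∂P) * ∫ ω, Complex.exp ((ξ * X (t - r) ω : ℝ) * Complex.I) ∂P := by
  have hg : Measurable fun y : ℝ => Complex.exp ((ξ * y : ℝ) * Complex.I) := by fun_prop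
  have hBW : StronglyMeasurable[ℱ r] (B.indicator W) := hW.indicator hB
  have hinc : Measurable fun ω => X t ω - X r ω :=
    (hX.measurable (hr.trans hrt)).sub (hX.measurable hr)
  have hind : IndepFun (B.indicator W)
      (fun ω => Complex.exp ((ξ * (X t ω - X r ω) : ℝ) * Complex.I)) P := by
    refine (indep_of_indep_of_le_left (indep_of_indep_of_le_right
      (hX.indepIncrements r t hr hrt) hBW.measurable.comap_le) ?_).symm
    rintro _ ⟨S, hS, rfl⟩
    exact ⟨_, hg hS, rfl⟩
  have h1 := hind.integral_fun_mul_eq_mul_integral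
    (hBW.mono (ℱ.le r)).aestronglyMeasurable (hg.comp hinc).aestronglyMeasurable
  have h2 : ∫ ω, Complex.exp ((ξ * (X t ω - X r ω) : ℝ) * Complex.I) ∂P =
      ∫ ω, Complex.exp ((ξ * X (t - r) ω : ℝ) * Complex.I) ∂P := by
    rw [← integral_map (φ := fun ω => X t ω - X r ω)
      (f := fun y : ℝ => Complex.exp ((ξ * y : ℝ) * Complex.I)) hinc.aemeasurable
      hg.aestronglyMeasurable, hX.stationary r t hr hrt,
      integral_map (hX.measurable (sub_nonneg.2 hrt)).aemeasurable hg.aestronglyMeasurable]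
  rw [← integral_indicator (ℱ.le r _ hB), ← integral_indicator (ℱ.le r _ hB), ← h2, ← h1]
  congr with ω
  by_cases h : ω ∈ B <;> simp [h]

/-- A linear combination of the values of `y` on `I` and at the last point `r` of `I`
is a linear combination of the values of `y` on `I`. -/
lemma exists_sum_add_last (I : Finset ℝ≥0) (ξ : ℝ≥0 → ℝ) (c : ℝ) :
    ∃ ξ' : ℝ≥0 → ℝ, ∀ y : ℝ≥0 → ℝ, y 0 = 0 →
      ∑ u ∈ I, ξ u * y u + c * y (I.sup id) = ∑ u ∈ I, ξ' u * y u := by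
  rcases I.eq_empty_or_nonempty with rfl | hI
  · exact ⟨ξ, fun y hy => by simp [hy]⟩
  · have hmem : I.sup id ∈ I := by
      obtain ⟨i, hi, h⟩ := I.exists_mem_eq_sup hI id
      rw [h]; exact hi
    refine ⟨fun u => ξ u + if u = I.sup id then c else 0, fun y _ => ?_⟩
    simp only [add_mul, Finset.sum_add_distrib, ite_mul, zero_mul]
    rw [Finset.sum_ite_eq' I (I.sup id), if_pos hmem]

lemma IsLevy.setIntegral_exp_increments (hX : IsLevy P ℱ X) (I : Finset ℝ≥0) :
    ∀ (ξ : ℝ≥0 → ℝ) {s : ℝ} (_ : 0 ≤ s) {B : Set Ω} (_ : MeasurableSet[ℱ s] B),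
    ∫ ω in B, Complex.exp ((∑ u ∈ I, ξ u * (X (s + u) ω - X s ω) : ℝ) * Complex.I) ∂P =
      (P.real B : ℂ) *
        ∫ ω, Complex.exp ((∑ u ∈ I, ξ u * (X u ω - X 0 ω) : ℝ) * Complex.I) ∂P := by
  have := hX.isProb
  induction I using Finset.induction_on_max with
  | empty => intro ξ s hs B hB; simp
  | insert m I hI ih =>
    intro ξ
    obtain ⟨ξ', hξ'⟩ := exists_sum_add_last I ξ (ξ m)
    set r := I.sup id with hr
    have hrm : r ≤ m := Finset.sup_le fun u hu => (hI u hu).le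
    have key : ∀ {s : ℝ} (_ : 0 ≤ s) {B : Set Ω} (_ : MeasurableSet[ℱ s] B),
        ∫ ω in B, Complex.exp ((∑ u ∈ insert m I, ξ u * (X (s + u) ω - X s ω) : ℝ)
          * Complex.I) ∂P =
        (∫ ω in B, Complex.exp ((∑ u ∈ I, ξ' u * (X (s + u) ω - X s ω) : ℝ) * Complex.I) ∂P) *
          ∫ ω, Complex.exp ((ξ m * X (m - r) ω : ℝ) * Complex.I) ∂P := by
      intro s hs B hB
      have hW : StronglyMeasurable[ℱ (s + r)] fun ω =>
          Complex.exp ((∑ u ∈ I, ξ' u * (X (s + u) ω - X s ω) : ℝ) * Complex.I) := by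
        have h1 : Measurable[ℱ (s + r)]
            fun ω => ∑ u ∈ I, ξ' u * (X (s + u) ω - X s ω) := by
          refine Finset.measurable_fun_sum I fun u hu => ?_
          have hur : (u : ℝ) ≤ r := NNReal.coe_le_coe.2 (Finset.le_sup (f := id) hu)
          have a1 : Measurable[ℱ (s + r)] (X (s + u)) :=
            ((hX.adapted (s + u) (by positivity)).mono (ℱ.mono (by linarith))).measurable
          have a2 : Measurable[ℱ (s + r)] (X s) :=
            ((hX.adapted s hs).mono (ℱ.mono (by simp))).measurable
          exact (a1.sub a2).const_mul _
        have h2 : Measurable fun y : ℝ => Complex.exp ((y : ℂ) * Complex.I) := by fun_prop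
        exact (h2.comp h1).stronglyMeasurable
      have hB' : MeasurableSet[ℱ (s + r)] B := ℱ.mono (by simp) _ hB
      have h := hX.integral_mul_exp_increment (t := s + m) (by positivity)
        (by simpa using hrm) hW hB' (ξ m)
      rw [show s + (m : ℝ) - (s + r) = m - r by ring] at h
      rw [← h]
      congr with ω
      have hy := hξ' (fun u => X (s + u) ω - X s ω) (by simp)
      rw [← Complex.exp_add, ← add_mul, ← Complex.ofReal_add, ← hy,
        Finset.sum_insert (fun h => lt_irrefl _ (hI m h))]
      congr 3
      ring
    intro s hs B hB
    rw [key hs hB, ih ξ' hs hB]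
    have h0 := key le_rfl (MeasurableSet.univ (α := Ω) (m := ℱ 0))
    simp only [setIntegral_univ, zero_add] at h0
    rw [h0, mul_assoc]

lemma IsLevy.measurable_eval (hX : IsLevy P ℱ X) {ρ : Ω → ℝ} (hρ : Measurable ρ)
    (h0 : ∀ ω, 0 ≤ ρ ω) : Measurable fun ω => X (ρ ω) ω :=
  measurable_eval_of_rightCont (fun _ ht => hX.measurable ht) hX.rightCont hρ h0

lemma IsLevy.setIntegral_exp_shift (hX : IsLevy P ℱ X) {ρ : Ω → ℝ} (hρ : Measurable ρ)
    (h0 : ∀ ω, 0 ≤ ρ ω) {B : Set Ω} (hB : ∀ s, 0 ≤ s → MeasurableSet[ℱ s] (B ∩ {ω | ρ ω < s}))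
    (I : Finset ℝ≥0) (ξ : ℝ≥0 → ℝ) :
    ∫ ω in B, Complex.exp ((∑ u ∈ I, ξ u * (X (ρ ω + u) ω - X (ρ ω) ω) : ℝ) * Complex.I) ∂P =
      (P.real B : ℂ) * ∫ ω, Complex.exp ((∑ u ∈ I, ξ u * X u ω : ℝ) * Complex.I) ∂P := by
  have := hX.isProb
  have hnorm : ∀ y : ℝ, ‖Complex.exp ((y : ℂ) * Complex.I)‖ = 1 := Complex.norm_exp_ofReal_mul_I
  have hexp : Measurable fun y : ℝ => Complex.exp ((y : ℂ) * Complex.I) := by fun_prop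
  have hmeas : ∀ {τ : Ω → ℝ} (_ : Measurable τ) (_ : ∀ ω, 0 ≤ τ ω), Measurable fun ω =>
      Complex.exp ((∑ u ∈ I, ξ u * (X (τ ω + u) ω - X (τ ω) ω) : ℝ) * Complex.I) := by
    intro τ hτ hτ0
    refine hexp.comp (Finset.measurable_fun_sum I fun u _ => Measurable.const_mul ?_ _)
    exact (hX.measurable_eval (hτ.add_const _) fun ω => add_nonneg (hτ0 ω) u.2).sub
      (hX.measurable_eval hτ hτ0)
  set φ : ℂ := ∫ ω, Complex.exp ((∑ u ∈ I, ξ u * X u ω : ℝ) * Complex.I) ∂P with hφ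
  have hφ' : φ = ∫ ω, Complex.exp ((∑ u ∈ I, ξ u * (X u ω - X 0 ω) : ℝ) * Complex.I) ∂P := by
    refine integral_congr_ae ?_
    filter_upwards [hX.zero] with ω hω
    simp [hω]
  have hgrid : ∀ n : ℕ, ∫ ω in B, Complex.exp ((∑ u ∈ I, ξ u *
      (X (gridAbove n (ρ ω) + u) ω - X (gridAbove n (ρ ω)) ω) : ℝ) * Complex.I) ∂P =
      (P.real B : ℂ) * φ := by
    intro n
    have hn : (0 : ℝ) < n + 1 := by positivity
    set A : ℕ → Set Ω := fun k => B ∩ {ω | ⌊((n : ℝ) + 1) * ρ ω⌋₊ = k} with hA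
    have hAF : ∀ k : ℕ, MeasurableSet[ℱ (((k : ℝ) + 1) / ((n : ℝ) + 1))] (A k) := by
      intro k
      have : A k = (B ∩ {ω | ρ ω < ((k : ℝ) + 1) / ((n : ℝ) + 1)}) \
          (B ∩ {ω | ρ ω < (k : ℝ) / ((n : ℝ) + 1)}) := by
        ext ω
        simp only [hA, mem_inter_iff, mem_ofPred_eq, Set.mem_sdiff, lt_div_iff₀ hn,
          Nat.floor_eq_iff (mul_nonneg hn.le (h0 ω))]
        rw [mul_comm (ρ ω)]
        constructor
        · rintro ⟨a, b, c⟩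
          exact ⟨⟨a, c⟩, fun h => absurd h.2 (not_lt.2 b)⟩
        · rintro ⟨⟨a, b⟩, c⟩
          exact ⟨a, not_lt.1 fun h => c ⟨a, h⟩, b⟩
      rw [this]
      refine (hB _ (by positivity)).diff (ℱ.mono ?_ _ (hB _ (by positivity)))
      gcongr
      linarith
    have hAm : ∀ k : ℕ, MeasurableSet (A k) := fun k => ℱ.le _ _ (hAF k)
    have hAd : Pairwise (Function.onFun Disjoint A) := by
      intro i j hij
      refine Set.disjoint_left.2 fun ω hi hj => hij ?_
      exact hi.2.symm.trans hj.2
    have hAU : B = ⋃ k, A k := by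
      ext ω
      simp [hA]
    have hint : ∀ k, ∫ ω in A k, Complex.exp ((∑ u ∈ I, ξ u *
        (X (gridAbove n (ρ ω) + u) ω - X (gridAbove n (ρ ω)) ω) : ℝ) * Complex.I) ∂P =
        ∫ _ω in A k, φ ∂P := by
      intro k
      rw [setIntegral_const, hφ', Complex.real_smul,
        ← hX.setIntegral_exp_increments I ξ (by positivity) (hAF k)]
      refine setIntegral_congr_fun (hAm k) fun ω hω => ?_
      have : ⌊((n : ℝ) + 1) * ρ ω⌋₊ = k := hω.2
      simp only [gridAbove, this]
    have hbd : Integrable (fun ω => Complex.exp ((∑ u ∈ I, ξ u *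
        (X (gridAbove n (ρ ω) + u) ω - X (gridAbove n (ρ ω)) ω) : ℝ) * Complex.I)) P := by
      refine Integrable.of_bound (C := 1) (hmeas (measurable_gridAbove hρ n)
        fun ω => gridAbove_nonneg n _).aestronglyMeasurable (Eventually.of_forall fun ω => ?_)
      rw [hnorm]
    have h3 : ∫ _ω in B, φ ∂P = (P.real B : ℂ) * φ := by
      rw [setIntegral_const, Complex.real_smul]
    rw [← h3, hAU, integral_iUnion hAm hAd hbd.integrableOn,
      integral_iUnion hAm hAd (integrable_const φ).integrableOn]
    exact tsum_congr hint
  refine tendsto_nhds_unique (tendsto_integral_of_dominated_convergence (fun _ => (1 : ℝ))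
    (fun n => (hmeas (measurable_gridAbove hρ n)
      fun ω => gridAbove_nonneg n _).aestronglyMeasurable) (integrable_const _)
    (fun n => Eventually.of_forall fun ω => (hnorm _).le)
    (Eventually.of_forall fun ω => ?_)) ((tendsto_congr hgrid).2 tendsto_const_nhds)
  have hc : Continuous fun y : ℝ => Complex.exp ((y : ℂ) * Complex.I) := by fun_prop
  refine (hc.tendsto _).comp (tendsto_finsetSum I fun u _ => ?_)
  refine (Tendsto.sub ?_ ?_).const_mul _
  · refine ((hX.rightCont ω _ (add_nonneg (h0 ω) u.2)).tendsto).comp ?_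
    have h1 := tendsto_nhdsWithin_iff.1 (tendsto_gridAbove (h0 ω))
    exact tendsto_nhdsWithin_iff.2 ⟨h1.1.add_const _,
      h1.2.mono fun n hn => add_le_add_left (mem_Ici.1 hn) _⟩
  · exact ((hX.rightCont ω _ (h0 ω)).tendsto).comp (tendsto_gridAbove (h0 ω))

/-- The space of real-valued right-continuous paths on `[0, ∞)`. -/
abbrev RightContPath : Type :=
  {f : ℝ≥0 → ℝ // ∀ t : ℝ, 0 ≤ t → ContinuousWithinAt (fun s : ℝ => f s.toNNReal) (Ici t) t}

/-- The coordinate process on the path space. -/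
def coordProc (t : ℝ) (f : RightContPath) : ℝ := f.1 t.toNNReal

lemma measurable_coordProc (t : ℝ) : Measurable (coordProc t) :=
  (measurable_pi_apply t.toNNReal).comp measurable_subtype_coe

/-- The path of a right-continuous process. -/
def toPath {E : Type*} (Y : ℝ → E → ℝ)
    (hY : ∀ ω, ∀ t : ℝ, 0 ≤ t → ContinuousWithinAt (fun s => Y s ω) (Ici t) t) (ω : E) :
    RightContPath :=
  ⟨fun u => Y u ω, fun t ht => (hY ω t ht).congr
    (fun s hs => congrArg (Y · ω) (Real.coe_toNNReal s (ht.trans (mem_Ici.1 hs))))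
    (congrArg (Y · ω) (Real.coe_toNNReal t ht))⟩

lemma coordProc_toPath {E : Type*} {Y : ℝ → E → ℝ}
    (hY : ∀ ω, ∀ t : ℝ, 0 ≤ t → ContinuousWithinAt (fun s => Y s ω) (Ici t) t) (ω : E)
    {t : ℝ} (ht : 0 ≤ t) : coordProc t (toPath Y hY ω) = Y t ω := by
  simp [coordProc, toPath, ht]

lemma measurable_toPath {E : Type*} {m : MeasurableSpace E} {Y : ℝ → E → ℝ}
    (hm : ∀ t, 0 ≤ t → Measurable (Y t))
    (hY : ∀ ω, ∀ t : ℝ, 0 ≤ t → ContinuousWithinAt (fun s => Y s ω) (Ici t) t) :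
    Measurable (toPath Y hY) :=
  (measurable_pi_lambda _ fun u : ℝ≥0 => hm u u.2).subtype_mk

/-- The discounted payoff at the first passage time below zero of the process started at `z`. -/
def passagePayoff {E : Type*} (X : ℝ → E → ℝ) (α β z : ℝ) (ω : E) : ℝ :=
  if hitsBelow X (-z) ω then
    Real.exp (-(α * tauBelow X (-z) ω) + β * (z + X (tauBelow X (-z) ω) ω)) else 0

lemma passagePayoff_congr {E E' : Type*} {X : ℝ → E → ℝ} {X' : ℝ → E' → ℝ} {ω : E} {ω' : E'}
    (h : ∀ t, 0 ≤ t → X t ω = X' t ω') (α β z : ℝ) :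
    passagePayoff X α β z ω = passagePayoff X' α β z ω' := by
  have h1 : hitsBelow X (-z) ω ↔ hitsBelow X' (-z) ω' :=
    exists_congr fun t => and_congr_right fun ht => by rw [h t ht]
  have h2 : tauBelow X (-z) ω = tauBelow X' (-z) ω' := by
    unfold tauBelow
    congr 1
    ext t
    exact and_congr_right fun ht => by rw [h t ht]
  simp only [passagePayoff, h1, h2, h _ (tauBelow_nonneg X' (-z) ω')]

lemma measurable_passagePayoff {E : Type*} {m : MeasurableSpace E} {X : ℝ → E → ℝ}
    (hm : ∀ t, 0 ≤ t → Measurable (X t))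
    (hr : ∀ ω, ∀ t : ℝ, 0 ≤ t → ContinuousWithinAt (fun s => X s ω) (Ici t) t) (α β : ℝ) :
    Measurable fun p : ℝ × E => passagePayoff X α β p.1 p.2 := by
  set Y : ℝ → ℝ × E → ℝ := fun t p => p.1 + X t p.2 with hY
  have hYm : ∀ t, 0 ≤ t → Measurable (Y t) := fun t ht =>
    measurable_fst.add ((hm t ht).comp measurable_snd)
  have hYr : ∀ p, ∀ t : ℝ, 0 ≤ t → ContinuousWithinAt (fun s => Y s p) (Ici t) t :=
    fun p t ht => (hr p.2 t ht).const_add p.1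
  have hlt : ∀ p t, X t p.2 < -p.1 ↔ Y t p < 0 := fun p t => by
    simp only [hY]; constructor <;> intro h <;> linarith
  have heq : (fun p : ℝ × E => passagePayoff X α β p.1 p.2) = fun p =>
      if hitsBelow Y 0 p then
        Real.exp (-(α * tauBelow Y 0 p) + β * Y (tauBelow Y 0 p) p) else 0 := by
    ext p
    simp only [passagePayoff, hitsBelow, tauBelow, hlt]
    rfl
  rw [heq]
  have hτ := measurable_tauBelow hYm hYr 0
  refine Measurable.ite (measurableSet_hitsBelow hYm hYr 0) ?_ measurable_const
  exact Real.measurable_exp.comp ((hτ.const_mul α).neg.add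
    ((measurable_eval_of_rightCont hYm hYr hτ (tauBelow_nonneg Y 0)).const_mul β))

lemma passagePayoff_nonneg {E : Type*} (X : ℝ → E → ℝ) (α β z : ℝ) (ω : E) :
    0 ≤ passagePayoff X α β z ω := by
  unfold passagePayoff
  split_ifs <;> positivity

lemma passagePayoff_le_one {E : Type*} {X : ℝ → E → ℝ} {α β : ℝ} (hα : 0 ≤ α) (hβ : 0 ≤ β)
    {ω : E} (hr : ∀ t : ℝ, 0 ≤ t → ContinuousWithinAt (fun s => X s ω) (Ici t) t) (z : ℝ) :
    passagePayoff X α β z ω ≤ 1 := by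
  unfold passagePayoff
  split_ifs with h
  · have h1 := apply_tauBelow_le hr h
    have h2 := mul_nonneg hα (tauBelow_nonneg X (-z) ω)
    have h3 := mul_nonneg hβ (by linarith : 0 ≤ -(z + X (tauBelow X (-z) ω) ω))
    exact Real.exp_le_one_iff.2 (by linarith)
  · exact zero_le_one

lemma rightCont_coordProc (f : RightContPath) (t : ℝ) (ht : 0 ≤ t) :
    ContinuousWithinAt (fun s => coordProc s f) (Ici t) t := f.2 t ht

lemma IsLevy.rightCont_shift (hX : IsLevy P ℱ X) {ρ : Ω → ℝ} (h0 : ∀ ω, 0 ≤ ρ ω) (ω : Ω) (t : ℝ)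
    (ht : 0 ≤ t) : ContinuousWithinAt (fun s => X (ρ ω + s) ω - X (ρ ω) ω) (Ici t) t := by
  refine ContinuousWithinAt.sub ?_ continuousWithinAt_const
  refine (hX.rightCont ω (ρ ω + t) (add_nonneg (h0 ω) ht)).comp
    (f := fun s => ρ ω + s) (by fun_prop) fun s hs => ?_
  exact add_le_add_right (mem_Ici.1 hs) _

lemma IsLevy.measurable_shift (hX : IsLevy P ℱ X) {ρ : Ω → ℝ} (hρ : Measurable ρ)
    (h0 : ∀ ω, 0 ≤ ρ ω) (t : ℝ) (ht : 0 ≤ t) :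
    Measurable fun ω => X (ρ ω + t) ω - X (ρ ω) ω :=
  (hX.measurable_eval (hρ.add_const _) fun ω => add_nonneg (h0 ω) ht).sub
    (hX.measurable_eval hρ h0)

/-- Strong Markov property: the path after a stopping time is independent of the past
and has the law of the process. -/
lemma IsLevy.map_shift (hX : IsLevy P ℱ X) {ρ : Ω → ℝ} (hρ : Measurable ρ)
    (h0 : ∀ ω, 0 ≤ ρ ω) {B : Set Ω} (hB : ∀ s, 0 ≤ s → MeasurableSet[ℱ s] (B ∩ {ω | ρ ω < s})) :
    (P.restrict B).map (toPath (fun s ω => X (ρ ω + s) ω - X (ρ ω) ω) (hX.rightCont_shift h0)) =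
      P B • P.map (toPath X hX.rightCont) := by
  have := hX.isProb
  have hY := hX.measurable_shift hρ h0
  have hYp : Measurable fun ω (u : ℝ≥0) => X (ρ ω + u) ω - X (ρ ω) ω :=
    measurable_pi_lambda _ fun u => hY u u.2
  have hXp : Measurable fun ω (u : ℝ≥0) => X u ω :=
    measurable_pi_lambda _ fun u => hX.measurable u.2
  have hpi : (P.restrict B).map (fun ω (u : ℝ≥0) => X (ρ ω + u) ω - X (ρ ω) ω) =
      P B • P.map (fun ω (u : ℝ≥0) => X u ω) := by
    have hfin : IsFiniteMeasure (P B • P.map (fun ω (u : ℝ≥0) => X u ω)) :=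
      Measure.smul_finite _ (measure_ne_top P B)
    refine IsProjectiveLimit.unique
      (P := fun I => ((P.restrict B).map
        (fun ω (u : ℝ≥0) => X (ρ ω + u) ω - X (ρ ω) ω)).map I.restrict)
      (fun I => rfl) fun I => ?_
    refine Measure.ext_of_charFunDual (funext fun L => ?_)
    have hexp : Measurable fun y : I → ℝ => Complex.exp ((L y : ℂ) * Complex.I) := by fun_prop
    have hL : ∀ y : ℝ≥0 → ℝ, L (I.restrict y) =
        ∑ u ∈ I, (if h : u ∈ I then L (Pi.single ⟨u, h⟩ 1) else 0) * y u := by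
      intro y
      have h := LinearMap.pi_apply_eq_sum_univ (L : (I → ℝ) →ₗ[ℝ] ℝ) (I.restrict y)
      rw [← Finset.sum_coe_sort I]
      refine h.trans (Finset.sum_congr rfl fun u _ => ?_)
      have hs : (fun j => if u = j then (1 : ℝ) else 0) = Pi.single u 1 := by
        ext j; simp [Pi.single_apply, eq_comm]
      rw [hs, smul_eq_mul, mul_comm, dif_pos u.2]
      rfl
    have hres : Measurable fun y : ℝ≥0 → ℝ => Complex.exp ((L (I.restrict y) : ℂ) * Complex.I) :=
      hexp.comp (Finset.measurable_restrict I)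
    have hkey := hX.setIntegral_exp_shift hρ h0 hB I
      fun u => if h : u ∈ I then L (Pi.single ⟨u, h⟩ 1) else 0
    simp_rw [charFunDual_apply]
    rw [integral_map (by fun_prop) hexp.aestronglyMeasurable,
      integral_map (by fun_prop) hexp.aestronglyMeasurable, integral_smul_measure,
      integral_map hXp.aemeasurable hres.aestronglyMeasurable,
      integral_map hYp.aemeasurable hres.aestronglyMeasurable]
    simp_rw [hL]
    rw [hkey]
    rfl
  ext S hS
  obtain ⟨T, hT, rfl⟩ := hS
  have hp := congrArg (fun μ => μ T) hpi
  rw [Measure.map_apply (measurable_toPath hY _) (measurable_subtype_coe hT)]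
  rw [Measure.smul_apply, Measure.map_apply
    (measurable_toPath (fun t ht => hX.measurable ht) _) (measurable_subtype_coe hT)]
  simp only [Measure.smul_apply] at hp
  rw [Measure.map_apply hYp hT, Measure.map_apply hXp hT] at hp
  exact hp

lemma IsLevy.hAB_eq_integral_path (hX : IsLevy P ℱ X) (α β z : ℝ) :
    hAB P X α β z =
      ∫ f, passagePayoff coordProc α β z f ∂(P.map (toPath X hX.rightCont)) := by
  have hG : Measurable (passagePayoff coordProc α β z) := (measurable_passagePayoff
    (fun t _ => measurable_coordProc t) rightCont_coordProc α β).comp measurable_prodMk_left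
  rw [integral_map (measurable_toPath (fun t ht => hX.measurable ht) _).aemeasurable
    hG.aestronglyMeasurable]
  exact integral_congr_ae (Eventually.of_forall fun ω =>
    passagePayoff_congr (fun t ht => (coordProc_toPath hX.rightCont ω ht).symm) α β z)

lemma IsLevy.measurable_hAB (hX : IsLevy P ℱ X) (α β : ℝ) : Measurable (hAB P X α β) := by
  have := hX.isProb
  exact ((measurable_passagePayoff (fun t ht => hX.measurable ht) hX.rightCont α
    β).stronglyMeasurable.integral_prod_right').measurable

lemma hAB_nonneg (α β z : ℝ) : 0 ≤ hAB P X α β z :=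
  integral_nonneg fun ω => passagePayoff_nonneg X α β z ω

lemma IsLevy.integrable_passagePayoff (hX : IsLevy P ℱ X) {α β : ℝ} (hα : 0 ≤ α) (hβ : 0 ≤ β)
    (z : ℝ) : Integrable (passagePayoff X α β z) P := by
  have := hX.isProb
  refine Integrable.of_bound (C := 1) (((measurable_passagePayoff (fun t ht => hX.measurable ht)
    hX.rightCont α β).comp measurable_prodMk_left).aestronglyMeasurable)
    (Eventually.of_forall fun ω => ?_)
  rw [Real.norm_of_nonneg (passagePayoff_nonneg X α β z ω)]
  exact passagePayoff_le_one hα hβ (hX.rightCont ω) z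

lemma IsLevy.hAB_le_one (hX : IsLevy P ℱ X) {α β : ℝ} (hα : 0 ≤ α) (hβ : 0 ≤ β) (z : ℝ) :
    hAB P X α β z ≤ 1 := by
  have := hX.isProb
  calc hAB P X α β z ≤ ∫ _ω, (1 : ℝ) ∂P :=
        integral_mono (hX.integrable_passagePayoff hα hβ z) (integrable_const _)
          fun ω => passagePayoff_le_one hα hβ (hX.rightCont ω) z
    _ = 1 := by simp

lemma IsLevy.setIntegral_passagePayoff_shift (hX : IsLevy P ℱ X) {α β : ℝ} (hα : 0 ≤ α)
    (hβ : 0 ≤ β) {ρ : Ω → ℝ} (hρ : Measurable ρ) (h0 : ∀ ω, 0 ≤ ρ ω) {B : Set Ω}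
    {V : Ω → ℝ} (hV : Measurable V)
    (hB : ∀ A, MeasurableSet A → ∀ s, 0 ≤ s → MeasurableSet[ℱ s] (B ∩ V ⁻¹' A ∩ {ω | ρ ω < s})) :
    ∫ ω in B, passagePayoff (fun s ω => X (ρ ω + s) ω - X (ρ ω) ω) α β (V ω) ω ∂P =
      ∫ ω in B, hAB P X α β (V ω) ∂P := by
  have := hX.isProb
  have hG := measurable_passagePayoff (fun t _ => measurable_coordProc t) rightCont_coordProc α β
  have hYr := hX.rightCont_shift h0
  have hYm := measurable_toPath (hX.measurable_shift hρ h0) hYr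
  have hXm := measurable_toPath (fun t ht => hX.measurable ht) hX.rightCont
  have hjoint : (P.restrict B).map (fun ω => (V ω, toPath _ hYr ω)) =
      ((P.restrict B).map V).prod (P.map (toPath X hX.rightCont)) := by
    refine (Measure.prod_eq fun A C hA hC => ?_).symm
    have h1 := congrArg (fun μ => μ C) (hX.map_shift hρ h0 (hB A hA))
    simp only [Measure.smul_apply, smul_eq_mul] at h1
    rw [Measure.map_apply hYm hC, Measure.restrict_apply (hYm hC)] at h1
    rw [Measure.map_apply (hV.prodMk hYm) (hA.prod hC),
      Measure.restrict_apply ((hV.prodMk hYm) (hA.prod hC)), Measure.map_apply hV hA,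
      Measure.restrict_apply (hV hA), inter_comm (V ⁻¹' A), ← h1]
    congr 1
    ext ω
    simp only [mem_inter_iff, mem_preimage, mem_prod]
    tauto
  have hprob : IsProbabilityMeasure (P.map (toPath X hX.rightCont)) :=
    Measure.isProbabilityMeasure_map hXm.aemeasurable
  calc ∫ ω in B, passagePayoff (fun s ω => X (ρ ω + s) ω - X (ρ ω) ω) α β (V ω) ω ∂P
      = ∫ ω in B, passagePayoff coordProc α β (V ω) (toPath _ hYr ω) ∂P :=
        integral_congr_ae (Eventually.of_forall fun ω =>
          passagePayoff_congr (fun t ht => (coordProc_toPath hYr ω ht).symm) α β _)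
    _ = ∫ p, passagePayoff coordProc α β p.1 p.2
          ∂((P.restrict B).map V).prod (P.map (toPath X hX.rightCont)) := by
        rw [← hjoint, integral_map (hV.prodMk hYm).aemeasurable hG.aestronglyMeasurable]
    _ = ∫ z, hAB P X α β z ∂((P.restrict B).map V) := by
        rw [integral_prod]
        · simp_rw [hX.hAB_eq_integral_path]
        · refine Integrable.of_bound (C := 1) hG.aestronglyMeasurable
            (Eventually.of_forall fun p => ?_)
          rw [Real.norm_of_nonneg (passagePayoff_nonneg _ α β _ _)]
          exact passagePayoff_le_one hα hβ (rightCont_coordProc p.2) _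
    _ = ∫ ω in B, hAB P X α β (V ω) ∂P :=
        integral_map hV.aemeasurable (hX.measurable_hAB α β).aestronglyMeasurable

lemma stoppedClock_eq {E : Type*} (X : ℝ → E → ℝ) (x : ℝ) {t : ℝ} (ht : 0 ≤ t) (ω : E) :
    stoppedClock X 0 x t ω =
      if hitsBelow X (-x) ω then min t (tauBelow X (-x) ω) else t := by
  have hlt : ∀ u, x + X u ω < 0 ↔ X u ω < -x := fun u => by
    constructor <;> intro h <;> linarith
  simp only [stoppedClock, hitBelowE, hlt]
  by_cases h : hitsBelow X (-x) ω
  · have h' : ∃ t, 0 ≤ t ∧ X t ω < -x := h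
    rw [if_pos h', if_pos h, ← ENNReal.ofReal_min, ENNReal.toReal_ofReal]
    · rfl
    · exact le_min ht (tauBelow_nonneg X (-x) ω)
  · have h' : ¬ ∃ t, 0 ≤ t ∧ X t ω < -x := h
    rw [if_neg h', if_neg h, min_eq_left le_top, ENNReal.toReal_ofReal ht]

lemma stoppedClock_nonneg {E : Type*} (X : ℝ → E → ℝ) (x t : ℝ) (ω : E) : 0 ≤ stoppedClock X 0 x t ω :=
  ENNReal.toReal_nonneg

lemma stoppedClock_le {E : Type*} (X : ℝ → E → ℝ) (x : ℝ) {t : ℝ} (ht : 0 ≤ t) (ω : E) :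
    stoppedClock X 0 x t ω ≤ t := by
  rw [stoppedClock_eq X x ht]
  split_ifs
  · exact min_le_left _ _
  · exact le_rfl

lemma stoppedClock_lt_iff {E : Type*} (X : ℝ → E → ℝ) (x : ℝ) {t : ℝ} (ht : 0 ≤ t) (s : ℝ) (ω : E) :
    stoppedClock X 0 x t ω < s ↔ t < s ∨ ∃ u, 0 ≤ u ∧ u < s ∧ X u ω < -x := by
  rw [stoppedClock_eq X x ht]
  split_ifs with h
  · rw [min_lt_iff, tauBelow_lt_iff h]
  · exact (or_iff_left fun ⟨u, h0, _, h1⟩ => h ⟨u, h0, h1⟩).symm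

lemma IsLevy.measurableSet_exists_lt (hX : IsLevy P ℱ X) {s t : ℝ} (hst : s ≤ t) (c : ℝ) :
    MeasurableSet[ℱ t] {ω | ∃ u, 0 ≤ u ∧ u < s ∧ X u ω < c} :=
  AKLevy.measurableSet_exists_lt (m := ℱ t) hX.rightCont c s fun u hu hus =>
    ((hX.adapted u hu).mono (ℱ.mono (hus.le.trans hst))).measurable

lemma IsLevy.measurable_stoppedClock (hX : IsLevy P ℱ X) (x : ℝ) {t : ℝ} (ht : 0 ≤ t) :
    Measurable[ℱ t] (stoppedClock X 0 x t) := by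
  refine measurable_of_Iio fun s => ?_
  have : stoppedClock X 0 x t ⁻¹' Iio s =
      {ω | t < s ∨ ∃ u, 0 ≤ u ∧ u < s ∧ X u ω < -x} := by
    ext ω
    exact stoppedClock_lt_iff X x ht s ω
  rw [this]
  rcases lt_or_ge t s with h | h
  · simp [h]
  · simpa only [not_lt.2 h, false_or] using hX.measurableSet_exists_lt h (-x)

lemma IsLevy.measurable_eval_stoppedClock (hX : IsLevy P ℱ X) (x : ℝ) {t : ℝ} (ht : 0 ≤ t) :
    Measurable[ℱ t] fun ω => X (stoppedClock X 0 x t ω) ω := by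
  have h := measurable_eval_of_rightCont (m := ℱ t) (X := fun u ω => X (min u t) ω)
    (fun u hu => ((hX.adapted _ (le_min hu ht)).mono (ℱ.mono (min_le_right u t))).measurable)
    (fun ω u hu => (hX.rightCont ω _ (le_min hu ht)).comp (f := fun s => min s t)
      (by fun_prop) fun s hs => min_le_min_right t (mem_Ici.1 hs))
    (hX.measurable_stoppedClock x ht) (stoppedClock_nonneg X x t)
  simpa only [min_eq_left (stoppedClock_le X x ht _)] using h

lemma IsLevy.hAB_of_neg (hX : IsLevy P ℱ X) (α β : ℝ) {y : ℝ} (hy : y < 0) :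
    hAB P X α β y = Real.exp (β * y) := by
  have := hX.isProb
  have h : (passagePayoff X α β y) =ᵐ[P] fun _ => Real.exp (β * y) := by
    filter_upwards [hX.zero] with ω hω
    have hmem : (0 : ℝ) ≤ 0 ∧ X 0 ω < -y := ⟨le_rfl, by rw [hω]; linarith⟩
    have hhit : hitsBelow X (-y) ω := ⟨0, hmem⟩
    have hτ : tauBelow X (-y) ω = 0 :=
      le_antisymm (csInf_le ⟨0, fun _ h => h.1⟩ hmem) (tauBelow_nonneg X (-y) ω)
    simp [passagePayoff, hhit, hτ, hω]
  exact (integral_congr_ae h).trans (by simp)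

/-- If the process creeps below `-x` with positive probability, then `0` is regular for the
negative half-line. -/
lemma IsLevy.hAB_zero (hX : IsLevy P ℱ X) {α β : ℝ} (hα : 0 ≤ α) (hβ : 0 ≤ β) {x : ℝ}
    (hP : P {ω | hitsBelow X (-x) ω ∧ x + X (tauBelow X (-x) ω) ω = 0} ≠ 0) :
    hAB P X α β 0 = 1 := by
  have := hX.isProb
  set B := {ω | hitsBelow X (-x) ω ∧ x + X (tauBelow X (-x) ω) ω = 0} with hB
  have hm : ∀ t, 0 ≤ t → Measurable (X t) := fun t ht => hX.measurable ht
  have hτ : Measurable (tauBelow X (-x)) := measurable_tauBelow hm hX.rightCont (-x)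
  have hτ0 := tauBelow_nonneg X (-x)
  have hBm : MeasurableSet B := (measurableSet_hitsBelow hm hX.rightCont (-x)).inter
    (measurableSet_eq_fun ((hX.measurable_eval hτ hτ0).const_add x) measurable_const)
  have hBs : ∀ s, 0 ≤ s → MeasurableSet[ℱ s] (B ∩ {ω | tauBelow X (-x) ω < s}) := by
    intro s hs
    have : B ∩ {ω | tauBelow X (-x) ω < s} = {ω | ∃ u, 0 ≤ u ∧ u < s ∧ X u ω < -x} ∩
        {ω | x + X (stoppedClock X 0 x s ω) ω = 0} := by
      ext ω
      by_cases h : hitsBelow X (-x) ω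
      · simp only [hB, mem_inter_iff, mem_ofPred_eq, h, true_and, ← tauBelow_lt_iff h,
          stoppedClock_eq X x hs, if_true]
        rw [and_comm]
        refine and_congr_right fun h' => ?_
        rw [min_eq_right h'.le]
      · simp only [hB, mem_inter_iff, mem_ofPred_eq, h, false_and, false_iff]
        rintro ⟨⟨u, h0, -, h1⟩, -⟩
        exact h ⟨u, h0, h1⟩
    rw [this]
    exact (hX.measurableSet_exists_lt le_rfl (-x)).inter (measurableSet_eq_fun
      ((hX.measurable_eval_stoppedClock x hs).const_add x) measurable_const)
  have hkey := hX.setIntegral_passagePayoff_shift hα hβ hτ hτ0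
    (V := fun _ => 0) measurable_const fun A _ s hs => by
      by_cases h : (0 : ℝ) ∈ A
      · simpa [h] using hBs s hs
      · simp [h]
  have hone : ∀ ω ∈ B, passagePayoff
      (fun s ω => X (tauBelow X (-x) ω + s) ω - X (tauBelow X (-x) ω) ω) α β 0 ω = 1 := by
    rintro ω ⟨hhit, hx⟩
    set τ := tauBelow X (-x) ω with hτ'
    set Y : ℝ → Ω → ℝ := fun s ω => X (tauBelow X (-x) ω + s) ω - X (tauBelow X (-x) ω) ω with hY
    have hnear : ∀ ε, 0 < ε → ∃ v, 0 ≤ v ∧ v < ε ∧ Y v ω < -0 := by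
      intro ε hε
      obtain ⟨u, hu0, hu1, hu2⟩ := (tauBelow_lt_iff hhit (τ + ε)).1 (by linarith)
      have hτu : τ ≤ u := csInf_le ⟨0, fun _ h => h.1⟩ ⟨hu0, hu2⟩
      refine ⟨u - τ, by linarith, by linarith, ?_⟩
      simp only [hY, ← hτ', add_sub_cancel]
      linarith
    have hYhit : hitsBelow Y (-0) ω := by
      obtain ⟨v, h0, -, h1⟩ := hnear 1 one_pos
      exact ⟨v, h0, h1⟩
    have hYτ : tauBelow Y (-0) ω = 0 :=
      le_antisymm (le_of_forall_pos_lt_add fun ε hε => by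
        rw [zero_add]; exact (tauBelow_lt_iff hYhit ε).2 (hnear ε hε)) (tauBelow_nonneg Y _ ω)
    rw [passagePayoff, if_pos hYhit, hYτ]
    simp [hY]
  rw [setIntegral_congr_fun hBm hone, setIntegral_const, setIntegral_const] at hkey
  have hpos : P.real B ≠ 0 := (measureReal_ne_zero_iff (measure_ne_top P B)).2 hP
  exact (mul_left_cancel₀ hpos hkey).symm

/-- The payoff in terms of the path after time `t`, on the event that level `-x` has not been crossed
before `t`. -/
lemma passagePayoff_eq_of_forall_le {E : Type*} {X : ℝ → E → ℝ} {x t : ℝ} (ht : 0 ≤ t) {ω : E}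
    (h : ∀ u, 0 ≤ u → u < t → -x ≤ X u ω) (α β : ℝ) :
    passagePayoff X α β x ω = Real.exp (-(α * t)) *
      passagePayoff (fun s ω => X (t + s) ω - X t ω) α β (x + X t ω) ω := by
  set Y : ℝ → E → ℝ := fun s ω => X (t + s) ω - X t ω with hY
  have hlt : ∀ s, (∃ u, 0 ≤ u ∧ u < s ∧ X u ω < -x) ↔
      ∃ v, 0 ≤ v ∧ v < s - t ∧ Y v ω < -(x + X t ω) := by
    intro s
    constructor
    · rintro ⟨u, h0, h1, h2⟩
      have htu : t ≤ u := not_lt.1 fun h' => absurd h2 (not_lt.2 (h u h0 h'))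
      refine ⟨u - t, by linarith, by linarith, ?_⟩
      simp only [hY, add_sub_cancel]
      linarith
    · rintro ⟨v, h0, h1, h2⟩
      simp only [hY] at h2
      exact ⟨t + v, by linarith, by linarith, by linarith⟩
  have hhit : hitsBelow X (-x) ω ↔ hitsBelow Y (-(x + X t ω)) ω := by
    constructor
    · rintro ⟨u, h0, h1⟩
      obtain ⟨v, h2, -, h3⟩ := (hlt (u + 1)).1 ⟨u, h0, by linarith, h1⟩
      exact ⟨v, h2, h3⟩
    · rintro ⟨v, h0, h1⟩
      obtain ⟨u, h2, -, h3⟩ := (hlt (t + v + 1)).2 ⟨v, h0, by linarith, h1⟩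
      exact ⟨u, h2, h3⟩
  by_cases hh : hitsBelow X (-x) ω
  · have hh' := hhit.1 hh
    have hτ : tauBelow X (-x) ω = t + tauBelow Y (-(x + X t ω)) ω := by
      refine eq_of_forall_gt_iff fun s => ?_
      rw [tauBelow_lt_iff hh, hlt, ← tauBelow_lt_iff hh', lt_sub_iff_add_lt']
    rw [passagePayoff, passagePayoff, if_pos hh, if_pos hh', hτ, ← Real.exp_add]
    simp only [hY]
    congr 1
    ring
  · rw [passagePayoff, passagePayoff, if_neg hh, if_neg (hhit.not.1 hh), mul_zero]

/-- The stopped discounted process is the closed martingale generated by the payoff. -/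
lemma IsLevy.stopped_ae_eq_condExp (hX : IsLevy P ℱ X) {α β : ℝ} (hα : 0 ≤ α) (hβ : 0 ≤ β)
    (x : ℝ) {t : ℝ} (ht : 0 ≤ t) :
    StronglyMeasurable[ℱ t] (fun ω => Real.exp (-(α * stoppedClock X 0 x t ω)) *
      hAB P X α β (x + X (stoppedClock X 0 x t ω) ω)) ∧
    Integrable (fun ω => Real.exp (-(α * stoppedClock X 0 x t ω)) *
      hAB P X α β (x + X (stoppedClock X 0 x t ω) ω)) P ∧
    (fun ω => Real.exp (-(α * stoppedClock X 0 x t ω)) *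
      hAB P X α β (x + X (stoppedClock X 0 x t ω) ω)) =ᵐ[P]
        P[passagePayoff X α β x | ℱ t] := by
  have := hX.isProb
  set M : Ω → ℝ := fun ω => Real.exp (-(α * stoppedClock X 0 x t ω)) *
      hAB P X α β (x + X (stoppedClock X 0 x t ω) ω) with hM
  have hMs : StronglyMeasurable[ℱ t] M := by
    refine Measurable.stronglyMeasurable (Measurable.mul ?_ ?_)
    · exact Real.measurable_exp.comp ((hX.measurable_stoppedClock x ht).const_mul α).neg
    · exact (hX.measurable_hAB α β).comp ((hX.measurable_eval_stoppedClock x ht).const_add x)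
  have hMi : Integrable M P := by
    refine Integrable.of_bound (C := 1) (hMs.mono (ℱ.le t)).aestronglyMeasurable
      (Eventually.of_forall fun ω => ?_)
    rw [Real.norm_of_nonneg (mul_nonneg (Real.exp_pos _).le (hAB_nonneg _ _ _))]
    exact mul_le_one₀ (Real.exp_le_one_iff.2 (by
      simpa using mul_nonneg hα (stoppedClock_nonneg X x t ω))) (hAB_nonneg _ _ _)
      (hX.hAB_le_one hα hβ _)
  have hZi := hX.integrable_passagePayoff hα hβ x
  refine ⟨hMs, hMi, ae_eq_condExp_of_forall_setIntegral_eq (ℱ.le t) hZi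
    (fun _ _ _ => hMi.integrableOn) (fun A hA _ => ?_) hMs.aestronglyMeasurable⟩
  set S := {ω | ∃ u, 0 ≤ u ∧ u < t ∧ X u ω < -x} with hS
  have hSF : MeasurableSet[ℱ t] S := hX.measurableSet_exists_lt le_rfl (-x)
  have hSm : MeasurableSet S := ℱ.le t _ hSF
  have hAm : MeasurableSet A := ℱ.le t _ hA
  rw [← integral_inter_add_sdiff hSm hMi.integrableOn,
    ← integral_inter_add_sdiff hSm hZi.integrableOn]
  congr 1
  · have hcreep : ∀ᵐ ω ∂P, hitsBelow X (-x) ω ∧ x + X (tauBelow X (-x) ω) ω = 0 →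
        hAB P X α β 0 = 1 := by
      by_cases hP : P {ω | hitsBelow X (-x) ω ∧ x + X (tauBelow X (-x) ω) ω = 0} = 0
      · filter_upwards [measure_eq_zero_iff_ae_notMem.1 hP] with ω hω h
        exact absurd h hω
      · exact Eventually.of_forall fun _ _ => hX.hAB_zero hα hβ hP
    refine setIntegral_congr_ae (hAm.inter hSm) ?_
    filter_upwards [hcreep] with ω hω hωS
    have hhit : hitsBelow X (-x) ω := by
      obtain ⟨u, h0, -, h1⟩ := hωS.2
      exact ⟨u, h0, h1⟩
    have hτt : tauBelow X (-x) ω < t := (tauBelow_lt_iff hhit t).2 hωS.2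
    have hle := apply_tauBelow_le (hX.rightCont ω) hhit
    simp only [hM, stoppedClock_eq X x ht, if_pos hhit, min_eq_right hτt.le]
    rw [passagePayoff, if_pos hhit, Real.exp_add]
    congr 1
    rcases lt_or_eq_of_le (by linarith : x + X (tauBelow X (-x) ω) ω ≤ 0) with h | h
    · exact hX.hAB_of_neg α β h
    · rw [h, hω ⟨hhit, h⟩, mul_zero, Real.exp_zero]
  · have hBF : MeasurableSet[ℱ t] (A \ S) := hA.diff hSF
    have hVF : Measurable[ℱ t] fun ω => x + X t ω := (hX.adapted t ht).measurable.const_add x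
    have hkey := hX.setIntegral_passagePayoff_shift hα hβ (ρ := fun _ => t) measurable_const
      (fun _ => ht) (hVF.mono (ℱ.le t) le_rfl) fun C hC s _ => by
        by_cases h : t < s
        · simpa [h] using ℱ.mono h.le _ (hBF.inter (hVF hC))
        · simp [h]
    have hout : ∀ ω ∈ A \ S, ∀ u, 0 ≤ u → u < t → -x ≤ X u ω := fun ω hω u h0 h1 =>
      not_lt.1 fun h => hω.2 ⟨u, h0, h1, h⟩
    have hL : ∀ ω ∈ A \ S, M ω = Real.exp (-(α * t)) * hAB P X α β (x + X t ω) := by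
      intro ω hω
      have : stoppedClock X 0 x t ω = t := by
        refine le_antisymm (stoppedClock_le X x ht ω) (not_lt.1 fun h => ?_)
        rcases (stoppedClock_lt_iff X x ht t ω).1 h with h | h
        · exact lt_irrefl _ h
        · exact hω.2 h
      simp only [hM, this]
    rw [setIntegral_congr_fun (hAm.diff hSm) hL, setIntegral_congr_fun (hAm.diff hSm)
      fun ω hω => passagePayoff_eq_of_forall_le ht (hout ω hω) α β,
      integral_const_mul, integral_const_mul, hkey]

end Markov

theorem stmt16 [m0 : MeasurableSpace Ω] (P : Measure Ω) (ℱ : Filtration ℝ m0)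
    (X : ℝ → Ω → ℝ) (hX : IsLevy P ℱ X) (α β : ℝ) (hα : 0 < α) (hβ : 0 ≤ β) :
    Measurable (hAB P X α β) ∧
    ∀ x : ℝ, MartOn P ℱ (fun t ω =>
      Real.exp (-(α * stoppedClock X 0 x t ω)) *
        hAB P X α β (x + X (stoppedClock X 0 x t ω) ω)) := by
  have := hX.isProb
  refine ⟨hX.measurable_hAB α β, fun x => ?_⟩
  have h := fun {t : ℝ} (ht : 0 ≤ t) => hX.stopped_ae_eq_condExp hα.le hβ x ht
  refine ⟨fun t ht => (h ht).1, fun t ht => (h ht).2.1, fun s t hs hst => ?_⟩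
  calc P[_ | ℱ s] =ᵐ[P] P[P[passagePayoff X α β x | ℱ t] | ℱ s] :=
        condExp_congr_ae (h (hs.trans hst)).2.2
    _ =ᵐ[P] P[passagePayoff X α β x | ℱ s] :=
        condExp_condExp_of_le (ℱ.mono hst) (ℱ.le t)
    _ =ᵐ[P] _ := (h hs).2.2.symm

end AKLevy
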